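/- Let ε ∈ (0,1), let L ≥ ε, let C > 0, and let Ω = (0,1)² ⊂ ℝ². Let g : ℝ² → ℝ be differentiable at every point of Ω with operator norm ‖Dg(X)‖ ≤ L for all X ∈ Ω, and suppose there exists X* ∈ Ω with g(X*) = 0. Then ∫_Ω exp((ε − g(X))/C) dX ≥ (π ε² / (16 L²)) · exp(ε / (2C)). -/

import Mathlib

open MeasureTheory

/-- The open unit square `(0,1)² ⊂ ℝ²` (with the Euclidean norm). -/
def unitSquare : Set (EuclideanSpace ℝ (Fin 2)) :=
  {X | ∀ i, X i ∈ Set.Ioo (0 : ℝ) 1}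

lemma isOpen_unitSquare : IsOpen unitSquare := by
  have h : unitSquare = ⋂ i, {X : EuclideanSpace ℝ (Fin 2) | X i ∈ Set.Ioo (0 : ℝ) 1} := by
    ext X
    simp [unitSquare]
  rw [h]
  exact isOpen_iInter_of_finite fun i =>
    isOpen_Ioo.preimage (by fun_prop : Continuous fun X : EuclideanSpace ℝ (Fin 2) => X i)

lemma convex_unitSquare : Convex ℝ unitSquare := fun _ hX _ hY _ _ ha hb hab i =>
  convex_Ioo (0 : ℝ) 1 (hX i) (hY i) ha hb hab

lemma norm_sub_le_two_of_mem_unitSquare {X Y : EuclideanSpace ℝ (Fin 2)}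
    (hX : X ∈ unitSquare) (hY : Y ∈ unitSquare) : ‖X - Y‖ ≤ 2 := by
  rw [EuclideanSpace.norm_eq, Real.sqrt_le_left (by norm_num)]
  simp only [Fin.sum_univ_two, PiLp.sub_apply, Real.norm_eq_abs, sq_abs]
  have hsq (i : Fin 2) : (X i - Y i) ^ 2 ≤ 1 := by
    rw [sq_le_one_iff_abs_le_one, abs_le]
    constructor <;> linarith [(hX i).1, (hX i).2, (hY i).1, (hY i).2]
  linarith [hsq 0, hsq 1]

lemma volume_unitSquare_lt_top : volume unitSquare < ⊤ :=
  (Metric.isBounded_iff.2 ⟨2, fun X hX Y hY => by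
    simpa [dist_eq_norm] using norm_sub_le_two_of_mem_unitSquare hX hY⟩).measure_lt_top

/-- The linear isometry of the plane that changes the sign of the coordinates selected by `σ`. -/
noncomputable def signFlip (σ : Fin 2 → Bool) :
    EuclideanSpace ℝ (Fin 2) ≃ₗᵢ[ℝ] EuclideanSpace ℝ (Fin 2) :=
  LinearIsometryEquiv.piLpCongrRight 2 fun i =>
    if σ i then LinearIsometryEquiv.neg ℝ else LinearIsometryEquiv.refl ℝ ℝ

lemma signFlip_apply (σ : Fin 2 → Bool) (X : EuclideanSpace ℝ (Fin 2)) (i : Fin 2) :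
    signFlip σ X i = if σ i then -X i else X i := by
  cases h : σ i <;> simp [signFlip, h]

/-- A disk of radius at most `1 / 2` centred in the unit square has at least a quarter of its area
inside the square. -/
lemma volume_ball_le_four_mul_volume_inter_unitSquare {X : EuclideanSpace ℝ (Fin 2)}
    (hX : X ∈ unitSquare) {r : ℝ} (hr : r ≤ 1 / 2) :
    volume (Metric.ball X r) ≤ 4 * volume (Metric.ball X r ∩ unitSquare) := by
  set A := Metric.ball X r ∩ unitSquare
  have hA : MeasurableSet A := (Metric.isOpen_ball.inter isOpen_unitSquare).measurableSet
  let R (σ : Fin 2 → Bool) (Y : EuclideanSpace ℝ (Fin 2)) := signFlip σ (Y - X) + X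
  have hR (σ : Fin 2 → Bool) : MeasurePreserving (R σ) :=
    (measurePreserving_add_right volume X).comp
      ((signFlip σ).measurePreserving.comp (measurePreserving_sub_right volume X))
  have hcover : Metric.ball X r ⊆ ⋃ σ, R σ ⁻¹' A := by
    classical
    intro Y hY
    rw [mem_ball_iff_norm] at hY
    refine Set.mem_iUnion.2 ⟨fun i => decide (Y i ∉ Set.Ioo (0 : ℝ) 1), ?_, fun i => ?_⟩
    · rw [mem_ball_iff_norm, add_sub_cancel_right, LinearIsometryEquiv.norm_map]
      exact hY
    · have hi : |Y i - X i| < 1 / 2 :=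
        ((PiLp.norm_apply_le (Y - X) i).trans_lt hY).trans_le hr
      obtain ⟨h₁, h₂⟩ := abs_lt.1 hi
      have hXi := hX i
      simp only [R, PiLp.add_apply, signFlip_apply, PiLp.sub_apply, decide_eq_true_eq]
      by_cases h : Y i ∈ Set.Ioo (0 : ℝ) 1
      · simp [h]
      · rw [if_pos h]
        rw [Set.mem_Ioo, not_and_or, not_lt, not_lt] at h
        rcases h with h | h <;> constructor <;> linarith [hXi.1, hXi.2]
  calc volume (Metric.ball X r) ≤ volume (⋃ σ, R σ ⁻¹' A) := measure_mono hcover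
    _ ≤ ∑ σ, volume (R σ ⁻¹' A) := measure_iUnion_fintype_le _ _
    _ = 4 * volume A := by
      simp [fun σ => (hR σ).measure_preimage hA.nullMeasurableSet]

lemma pi_mul_sq_div_four_le_volume_real_ball_inter_unitSquare {X : EuclideanSpace ℝ (Fin 2)}
    (hX : X ∈ unitSquare) {r : ℝ} (hr₀ : 0 ≤ r) (hr : r ≤ 1 / 2) :
    Real.pi * r ^ 2 / 4 ≤ volume.real (Metric.ball X r ∩ unitSquare) := by
  have hfin : volume (Metric.ball X r ∩ unitSquare) ≠ ⊤ :=
    ((measure_mono Set.inter_subset_right).trans_lt volume_unitSquare_lt_top).ne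
  have h := ENNReal.toReal_mono (ENNReal.mul_ne_top (by norm_num) hfin)
    (volume_ball_le_four_mul_volume_inter_unitSquare hX hr)
  rw [EuclideanSpace.volume_ball_fin_two] at h
  simp only [ENNReal.toReal_mul, ENNReal.toReal_pow, ENNReal.toReal_ofReal hr₀,
    ENNReal.toReal_ofNat, ENNReal.toReal_ofReal Real.pi_pos.le] at h
  rw [measureReal_def]
  linarith

/-- **Quantitative barrier estimate (Section 2.2).** If `g` is differentiable on
`Ω = (0,1)²` with `‖Dg‖ ≤ L` there and vanishes at some `X* ∈ Ω`, then
`∫_Ω exp((ε − g)/C) ≥ (π ε²/(16 L²)) exp(ε/(2C))`. -/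
theorem stmt_10 (ε L C : ℝ) (hε : ε ∈ Set.Ioo (0 : ℝ) 1) (hL : ε ≤ L) (hC : 0 < C)
    (g : EuclideanSpace ℝ (Fin 2) → ℝ)
    (hdiff : ∀ X ∈ unitSquare, DifferentiableAt ℝ g X)
    (hbound : ∀ X ∈ unitSquare, ‖fderiv ℝ g X‖ ≤ L)
    (Xstar : EuclideanSpace ℝ (Fin 2)) (hXstar : Xstar ∈ unitSquare)
    (hg0 : g Xstar = 0) :
    Real.pi * ε ^ 2 / (16 * L ^ 2) * Real.exp (ε / (2 * C)) ≤
      ∫ X in unitSquare, Real.exp ((ε - g X) / C) := by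
  obtain ⟨hε₀, -⟩ := hε
  have hL₀ : 0 < L := hε₀.trans_le hL
  have hlip : ∀ X ∈ unitSquare, |g X| ≤ L * ‖X - Xstar‖ := fun X hX => by
    simpa [hg0] using
      convex_unitSquare.norm_image_sub_le_of_norm_fderiv_le hdiff hbound hXstar hX
  have hint : IntegrableOn (fun X => Real.exp ((ε - g X) / C)) unitSquare := by
    have hcont : ContinuousOn g unitSquare := fun X hX =>
      (hdiff X hX).continuousAt.continuousWithinAt
    refine IntegrableOn.of_bound volume_unitSquare_lt_top
      (((continuousOn_const.sub hcont).div_const C).rexp.aestronglyMeasurable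
        isOpen_unitSquare.measurableSet) (Real.exp ((ε + L * 2) / C))
      (ae_restrict_of_forall_mem isOpen_unitSquare.measurableSet fun X hX => ?_)
    rw [Real.norm_eq_abs, Real.abs_exp]
    have hX₂ := mul_le_mul_of_nonneg_left (norm_sub_le_two_of_mem_unitSquare hX hXstar) hL₀.le
    gcongr
    linarith [(abs_le.1 (hlip X hX)).1]
  set r := ε / (2 * L) with hr
  have hr₂ : r ≤ 1 / 2 := by
    rw [hr, div_le_div_iff₀ (by positivity) (by norm_num)]
    linarith
  set A := Metric.ball Xstar r ∩ unitSquare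
  have hA : MeasurableSet A := (Metric.isOpen_ball.inter isOpen_unitSquare).measurableSet
  have hAfin : volume A ≠ ⊤ :=
    ((measure_mono Set.inter_subset_right).trans_lt volume_unitSquare_lt_top).ne
  have hlower : ∀ X ∈ A, Real.exp (ε / (2 * C)) ≤ Real.exp ((ε - g X) / C) := by
    rintro X ⟨hXr, hX⟩
    rw [mem_ball_iff_norm] at hXr
    have hgX : g X ≤ ε / 2 := calc
      g X ≤ L * ‖X - Xstar‖ := (le_abs_self _).trans (hlip X hX)
      _ ≤ L * r := by gcongr
      _ = ε / 2 := by rw [hr]; field_simp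
    rw [← div_div]
    gcongr
    linarith
  calc Real.pi * ε ^ 2 / (16 * L ^ 2) * Real.exp (ε / (2 * C))
      = Real.pi * r ^ 2 / 4 * Real.exp (ε / (2 * C)) := by rw [hr]; field_simp; norm_num
    _ ≤ volume.real A * Real.exp (ε / (2 * C)) := by
      gcongr
      exact pi_mul_sq_div_four_le_volume_real_ball_inter_unitSquare hXstar (by positivity) hr₂
    _ = ∫ _ in A, Real.exp (ε / (2 * C)) := by simp
    _ ≤ ∫ X in A, Real.exp ((ε - g X) / C) :=
      setIntegral_mono_on (integrableOn_const hAfin) (hint.mono_set Set.inter_subset_right)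
        hA hlower
    _ ≤ ∫ X in unitSquare, Real.exp ((ε - g X) / C) :=
      setIntegral_mono_set hint (ae_of_all _ fun _ => (Real.exp_pos _).le)
        Set.inter_subset_right.eventuallyLE
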